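/- Let n ≥ 1, let Σ_X and Σ_Y be symmetric positive definite n×n real matrices, and let σ > 0. For an invertible n×n real matrix A, define Δ(A) = ((σ²/4)·A⁻¹Σ_X⁻¹A⁻* + Σ_Y)^{1/2} and G(A) = Σ_X A Δ(A)(Δ(A)A*Σ_X A Δ(A))^{-1/2}Δ(A) − (σ/2)A⁻*. Fix an invertible A₀ and set Σ_XY = G(A₀). Then the linear map L on n×n real matrices defined by L(H) = (1/σ)·A₀·(Σ_Y Σ_XY⁻¹ H Σ_XY⁻¹ Σ_X + H*)·A₀ is bijective, G is Fréchet differentiable at A₀, and the derivative of G at A₀ equals the inverse linear map L⁻¹. -/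

import Mathlib

open Matrix Classical

attribute [local instance] Matrix.normedAddCommGroup Matrix.normedSpace

/-- The unique positive semidefinite square root of a positive semidefinite
real matrix (junk value `0` if the matrix is not positive semidefinite). -/
noncomputable def psdSqrt {n : ℕ} (M : Matrix (Fin n) (Fin n) ℝ) :
    Matrix (Fin n) (Fin n) ℝ :=
  if h : M.PosSemidef then
    (h.1.eigenvectorUnitary : Matrix (Fin n) (Fin n) ℝ) *
      diagonal (Real.sqrt ∘ h.1.eigenvalues) *
      (star h.1.eigenvectorUnitary : Matrix (Fin n) (Fin n) ℝ)
  else 0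


open Filter Topology

theorem lyap {n : ℕ} {X Y N : Matrix (Fin n) (Fin n) ℝ} (hX : X.PosSemidef) (hY : Y.PosDef)
    (h : N * X + Y * N = 0) : N = 0 := by
  have h1 : 0 ≤ (N * X * Nᴴ).trace := (hX.mul_mul_conjTranspose_same N).trace_nonneg
  have h2 := hY.posSemidef.conjTranspose_mul_mul_same N
  have h3 : (N * X * Nᴴ).trace + (Nᴴ * Y * N).trace = 0 := by
    rw [Matrix.trace_mul_comm, Matrix.mul_assoc, ← Matrix.trace_add, ← Matrix.mul_add, h]
    simp
  have h4 : (Nᴴ * Y * N).trace = 0 := le_antisymm (by linarith) h2.trace_nonneg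
  have h5 := h2.trace_eq_zero_iff.1 h4
  have : ∀ v, N *ᵥ v = 0 := by
    intro v
    by_contra hv
    have := hY.dotProduct_mulVec_pos hv
    have h6 : star (N *ᵥ v) ⬝ᵥ (Y *ᵥ (N *ᵥ v)) = star v ⬝ᵥ ((Nᴴ * Y * N) *ᵥ v) := by
      simp only [star_mulVec, dotProduct_mulVec, vecMul_vecMul, Matrix.mul_assoc]
    rw [h6, h5] at this
    simp at this
  ext i j
  have := congrFun (this (Pi.single j 1)) i
  simpa using this

theorem psdSqrt_psd {n : ℕ} {M : Matrix (Fin n) (Fin n) ℝ} (h : M.PosSemidef) :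
    (psdSqrt M).PosSemidef := by
  rw [psdSqrt, dif_pos h]
  exact (Matrix.PosSemidef.diagonal (fun i => Real.sqrt_nonneg _)).mul_mul_conjTranspose_same _

theorem psdSqrt_sq {n : ℕ} {M : Matrix (Fin n) (Fin n) ℝ} (h : M.PosSemidef) :
    psdSqrt M * psdSqrt M = M := by
  rw [psdSqrt, dif_pos h]
  have h1 := h.1.spectral_theorem
  rw [Unitary.conjStarAlgAut_apply] at h1
  conv_rhs => rw [h1]
  have h2 : (star h.1.eigenvectorUnitary : Matrix (Fin n) (Fin n) ℝ) *
    (h.1.eigenvectorUnitary : Matrix (Fin n) (Fin n) ℝ) = 1 := Unitary.coe_star_mul_self _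
  have h3 : diagonal (Real.sqrt ∘ h.1.eigenvalues) * diagonal (Real.sqrt ∘ h.1.eigenvalues)
      = diagonal (RCLike.ofReal ∘ h.1.eigenvalues : Fin n → ℝ) := by
    rw [diagonal_mul_diagonal]
    congr 1
    ext i
    simpa using Real.mul_self_sqrt (h.eigenvalues_nonneg i)
  rw [← h3]
  simp only [Matrix.mul_assoc]
  rw [← Matrix.mul_assoc (star _) _ (_ * _), h2, Matrix.one_mul]

theorem psdSqrt_pd {n : ℕ} {M : Matrix (Fin n) (Fin n) ℝ} (h : M.PosDef) :
    (psdSqrt M).PosDef := by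
  rw [(psdSqrt_psd h.posSemidef).posDef_iff_isUnit]
  have := h.isUnit
  rw [← psdSqrt_sq h.posSemidef] at this
  rw [Matrix.isUnit_iff_isUnit_det] at this ⊢
  rw [Matrix.det_mul] at this
  exact isUnit_of_mul_isUnit_left this

theorem psdSqrt_unique {n : ℕ} {M Y : Matrix (Fin n) (Fin n) ℝ} (hY : Y.PosDef)
    (h : Y * Y = M) : psdSqrt M = Y := by
  have hM : M.PosSemidef := by
    rw [← h]
    have := Matrix.posSemidef_conjTranspose_mul_self Y
    rwa [hY.1.eq] at this
  rw [← sub_eq_zero]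
  apply lyap (psdSqrt_psd hM) hY
  rw [Matrix.sub_mul, Matrix.mul_sub, psdSqrt_sq hM, h]
  abel

theorem pd_nhds {n : ℕ} {P : Matrix (Fin n) (Fin n) ℝ} (hP : P.PosDef) :
    ∀ᶠ Q in 𝓝 P, Q.IsHermitian → Q.PosDef := by
  have hK : IsCompact (Metric.sphere (0 : Fin n → ℝ) 1) := isCompact_sphere _ _
  have : ∀ᶠ Q in 𝓝 P, ∀ v ∈ Metric.sphere (0 : Fin n → ℝ) 1, 0 < v ⬝ᵥ (Q *ᵥ v) := by
    apply hK.eventually_forall_of_forall_eventually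
    intro v hv
    have hc : Continuous (fun z : Matrix (Fin n) (Fin n) ℝ × (Fin n → ℝ) =>
      z.2 ⬝ᵥ (z.1 *ᵥ z.2)) := by fun_prop
    apply hc.continuousAt.eventually
    apply lt_mem_nhds
    have hv0 : v ≠ 0 := by
      rintro rfl
      simp at hv
    simpa using hP.dotProduct_mulVec_pos hv0
  filter_upwards [this] with Q hQ hH
  refine .of_dotProduct_mulVec_pos hH fun v hv => ?_
  have hn : 0 < ‖v‖ := norm_pos_iff.2 hv
  have := hQ (‖v‖⁻¹ • v) (by simp [norm_smul, hn.ne'])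
  simp only [mulVec_smul, smul_dotProduct, dotProduct_smul, smul_eq_mul] at this
  have h2 := pos_of_mul_pos_right this (by positivity)
  simpa using pos_of_mul_pos_right h2 (by positivity)

theorem strict_inv_aux {R : Type*} [NormedRing R] [NormedAlgebra ℝ R] [CompleteSpace R] (u : Rˣ) :
    ∃ f' : R →L[ℝ] R, HasStrictFDerivAt Ring.inverse f' (u : R) ∧
      ∀ H, f' H = - ((↑u⁻¹ : R) * H * (↑u⁻¹ : R)) :=
  ⟨_, hasStrictFDerivAt_ringInverse (𝕜 := ℝ) u, fun H => by simp⟩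

theorem strict_inv {n : ℕ} {M : Matrix (Fin n) (Fin n) ℝ} (hM : IsUnit M.det) :
    ∃ f' : Matrix (Fin n) (Fin n) ℝ →L[ℝ] Matrix (Fin n) (Fin n) ℝ,
      HasStrictFDerivAt (fun X : Matrix (Fin n) (Fin n) ℝ => X⁻¹) f' M ∧
        ∀ H, f' H = - (M⁻¹ * H * M⁻¹) := by
  obtain ⟨u, rfl⟩ := (Matrix.isUnit_iff_isUnit_det _).2 hM
  have h2 : (fun X : Matrix (Fin n) (Fin n) ℝ => X⁻¹) = Ring.inverse := by
    ext1 X; exact Matrix.nonsing_inv_eq_ringInverse X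
  rw [h2, ← Matrix.coe_units_inv]
  exact @strict_inv_aux _ (Matrix.linftyOpNormedRing (n := Fin n) (α := ℝ))
    (Matrix.linftyOpNormedAlgebra (n := Fin n) (α := ℝ) (R := ℝ))
    (by
      let _ := Matrix.linftyOpNormedRing (n := Fin n) (α := ℝ)
      let _ := Matrix.linftyOpNormedAlgebra (n := Fin n) (α := ℝ) (R := ℝ)
      exact @FiniteDimensional.complete ℝ (Matrix (Fin n) (Fin n) ℝ) _ _ _ _ _ _ _ _ _) u

theorem sqrt_formula_unique {n : ℕ} {P K M : Matrix (Fin n) (Fin n) ℝ} (hP : P.PosDef)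
    (hM : M.PosDef) (h : P * K * P = M) :
    psdSqrt M * (psdSqrt (psdSqrt M * K * psdSqrt M))⁻¹ * psdSqrt M = P := by
  have hS := psdSqrt_pd hM
  have hs := psdSqrt_sq hM.posSemidef
  set S := psdSqrt M
  have uS : IsUnit S.det := (Matrix.isUnit_iff_isUnit_det _).1 hS.isUnit
  have uP : IsUnit P.det := (Matrix.isUnit_iff_isUnit_det _).1 hP.isUnit
  have hY : (S * P⁻¹ * S).PosDef := by
    have := hP.inv.mul_mul_conjTranspose_same (B := S)
      (Matrix.vecMul_injective_of_isUnit hS.isUnit)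
    rwa [hS.1.eq] at this
  have hK : K = P⁻¹ * M * P⁻¹ := by
    rw [← h]
    simp only [Matrix.mul_assoc]
    rw [Matrix.mul_nonsing_inv _ uP, Matrix.mul_one, ← Matrix.mul_assoc,
      Matrix.nonsing_inv_mul _ uP, Matrix.one_mul]
  rw [psdSqrt_unique hY]
  · rw [Matrix.mul_inv_rev, Matrix.mul_inv_rev, Matrix.nonsing_inv_nonsing_inv _ uP]
    simp only [Matrix.mul_assoc]
    rw [Matrix.nonsing_inv_mul _ uS, Matrix.mul_one, ← Matrix.mul_assoc,
      Matrix.mul_nonsing_inv _ uS, Matrix.one_mul]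
  · rw [hK, ← hs]
    simp only [Matrix.mul_assoc]

theorem sqrt_formula_exists {n : ℕ} {K M : Matrix (Fin n) (Fin n) ℝ} (hK : K.PosDef)
    (hM : M.PosDef) : ∃ P : Matrix (Fin n) (Fin n) ℝ, P.PosDef ∧ P * K * P = M ∧
      psdSqrt M * (psdSqrt (psdSqrt M * K * psdSqrt M))⁻¹ * psdSqrt M = P := by
  refine ⟨_, ?_, ?_, rfl⟩
  · have hS := psdSqrt_pd hM
    have hKK : (psdSqrt M * K * psdSqrt M).PosDef := by
      have := hK.mul_mul_conjTranspose_same (B := psdSqrt M)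
        (Matrix.vecMul_injective_of_isUnit hS.isUnit)
      rwa [hS.1.eq] at this
    have := (psdSqrt_pd hKK).inv.mul_mul_conjTranspose_same (B := psdSqrt M)
        (Matrix.vecMul_injective_of_isUnit hS.isUnit)
    rwa [hS.1.eq] at this
  · have hS := psdSqrt_pd hM
    have hs := psdSqrt_sq hM.posSemidef
    set S := psdSqrt M
    have hKK : (S * K * S).PosDef := by
      have := hK.mul_mul_conjTranspose_same (B := S)
        (Matrix.vecMul_injective_of_isUnit hS.isUnit)
      rwa [hS.1.eq] at this
    have hT := psdSqrt_pd hKK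
    have ht := psdSqrt_sq hKK.posSemidef
    set T := psdSqrt (S * K * S)
    have uT : IsUnit T.det := (Matrix.isUnit_iff_isUnit_det _).1 hT.isUnit
    calc S * T⁻¹ * S * K * (S * T⁻¹ * S) = S * T⁻¹ * (S * K * S) * T⁻¹ * S := by
          simp only [Matrix.mul_assoc]
      _ = S * (T⁻¹ * T) * (T * T⁻¹) * S := by rw [← ht]; simp only [Matrix.mul_assoc]
      _ = M := by
        rw [Matrix.mul_nonsing_inv _ uT, Matrix.nonsing_inv_mul _ uT, Matrix.mul_one,
          Matrix.mul_one, hs]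

/-- Injectivity of the symmetrized Sylvester operator. -/
theorem sylv_inj {n : ℕ} {B P D M : Matrix (Fin n) (Fin n) ℝ} {σ : ℝ} (hσ : σ ≠ 0)
    (hB : IsUnit B) (hP : P.PosDef) (hD : Dᵀ = D)
    (hPD : P * (Bᵀ * B) = D * (Bᵀ * B) + (σ / 2) • 1)
    (h : D * (Bᵀ * B) * M + σ • M + Mᵀ * (Bᵀ * B) * D = 0) : M = 0 := by
  have hMT : Mᵀ = M := by
    have h2 := congrArg Matrix.transpose h
    simp only [Matrix.transpose_add, Matrix.transpose_mul, Matrix.transpose_smul,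
      Matrix.transpose_transpose, hD, Matrix.transpose_zero] at h2
    have h3 : σ • (Mᵀ - M) = 0 := by
      rw [smul_sub, ← sub_eq_zero.2 (h2.trans h.symm)]
      simp only [Matrix.mul_assoc]
      abel
    exact sub_eq_zero.1 ((smul_eq_zero.1 h3).resolve_left hσ)
  have hPT : Pᵀ = P := by simpa using hP.1.eq
  have hPD' : (Bᵀ * B) * P = (Bᵀ * B) * D + (σ / 2) • 1 := by
    have := congrArg Matrix.transpose hPD
    simpa [hPT, hD, Matrix.mul_assoc] using this
  have h4 : P * (Bᵀ * B) * M + M * ((Bᵀ * B) * P) = 0 := by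
    rw [hPD, hPD', ← h, hMT, Matrix.add_mul, Matrix.mul_add]
    simp only [Matrix.smul_mul, Matrix.mul_smul, Matrix.one_mul, Matrix.mul_one, Matrix.mul_assoc]
    module
  have hR : (B * P * Bᵀ).PosDef := by
    have := hP.mul_mul_conjTranspose_same (B := B) (Matrix.vecMul_injective_of_isUnit hB)
    simpa using this
  have h5 : B * M * Bᵀ = 0 := by
    apply lyap hR.posSemidef hR
    have := congrArg (fun X => B * X * Bᵀ) h4
    simp only [Matrix.mul_add, Matrix.add_mul, Matrix.mul_zero, Matrix.zero_mul] at this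
    rw [← this, add_comm]
    simp only [Matrix.mul_assoc]
  have uB := (Matrix.isUnit_iff_isUnit_det _).1 hB
  have uBT : IsUnit (Bᵀ).det := by rwa [Matrix.det_transpose]
  calc M = B⁻¹ * (B * M * Bᵀ) * Bᵀ⁻¹ := by
        simp only [Matrix.mul_assoc]
        rw [Matrix.mul_nonsing_inv _ uBT, Matrix.mul_one, ← Matrix.mul_assoc,
          Matrix.nonsing_inv_mul _ uB, Matrix.one_mul]
    _ = 0 := by rw [h5]; simp

/-- Derivative of the identification map. -/
theorem strict_F {n : ℕ} {Sx Sy C : Matrix (Fin n) (Fin n) ℝ} {σ : ℝ} (hC : IsUnit C.det)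
    (hE : IsUnit (Sy * C⁻¹ * Sx - Cᵀ).det) :
    ∃ f' : Matrix (Fin n) (Fin n) ℝ →L[ℝ] Matrix (Fin n) (Fin n) ℝ,
      HasStrictFDerivAt (fun X : Matrix (Fin n) (Fin n) ℝ => σ • (Sy * X⁻¹ * Sx - Xᵀ)⁻¹) f' C ∧
        ∀ H, f' H = σ • ((Sy * C⁻¹ * Sx - Cᵀ)⁻¹ * (Sy * C⁻¹ * H * C⁻¹ * Sx + Hᵀ) *
          (Sy * C⁻¹ * Sx - Cᵀ)⁻¹) := by
  obtain ⟨f1, h1, e1⟩ := strict_inv hC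
  obtain ⟨f2, h2, e2⟩ := strict_inv hE
  let T1 : Matrix (Fin n) (Fin n) ℝ →L[ℝ] Matrix (Fin n) (Fin n) ℝ :=
    LinearMap.toContinuousLinearMap
      (LinearMap.mulRight ℝ Sx ∘ₗ LinearMap.mulLeft ℝ Sy)
  let T2 : Matrix (Fin n) (Fin n) ℝ →L[ℝ] Matrix (Fin n) (Fin n) ℝ :=
    LinearMap.toContinuousLinearMap
      (Matrix.transposeLinearEquiv (Fin n) (Fin n) ℝ ℝ).toLinearMap
  have h3 := (T1.hasStrictFDerivAt.comp C h1).sub (T2.hasStrictFDerivAt (x := C))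
  have h4 := (HasStrictFDerivAt.comp C (g := fun X : Matrix (Fin n) (Fin n) ℝ => X⁻¹)
    (f := fun X => T1 X⁻¹ - T2 X) h2 h3).const_smul σ
  refine ⟨_, h4, fun H => ?_⟩
  have : T1 (f1 H) - T2 H = - (Sy * C⁻¹ * H * C⁻¹ * Sx + Hᵀ) := by
    rw [e1]
    change Sy * (-(C⁻¹ * H * C⁻¹)) * Sx - Hᵀ = _
    rw [Matrix.mul_neg, Matrix.neg_mul, neg_add]
    simp only [Matrix.mul_assoc]
    rfl
  change σ • f2 (T1 (f1 H) - T2 H) = _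
  rw [this, e2]
  simp only [Matrix.mul_neg, Matrix.neg_mul, neg_neg]

/-- From the identification equation and positivity, recover the closed form. -/
theorem G_recover {n : ℕ} {Sx Sy A C : Matrix (Fin n) (Fin n) ℝ} {σ : ℝ} (hσ : 0 < σ)
    (hX : Sx.PosDef)
    (hY : Sy.PosDef) (uA : IsUnit A.det) (uC : IsUnit C.det)
    (hE : Sy * C⁻¹ * Sx - Cᵀ = σ • A⁻¹)
    (hP : (A⁻¹ * Sx⁻¹ * C + (σ / 2) • (A⁻¹ * Sx⁻¹ * (Aᵀ)⁻¹)).IsHermitian →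
      (A⁻¹ * Sx⁻¹ * C + (σ / 2) • (A⁻¹ * Sx⁻¹ * (Aᵀ)⁻¹)).PosDef) :
    Sx * A * psdSqrt ((σ ^ 2 / 4) • (A⁻¹ * Sx⁻¹ * (Aᵀ)⁻¹) + Sy) *
          (psdSqrt (psdSqrt ((σ ^ 2 / 4) • (A⁻¹ * Sx⁻¹ * (Aᵀ)⁻¹) + Sy) * Aᵀ * Sx * A *
              psdSqrt ((σ ^ 2 / 4) • (A⁻¹ * Sx⁻¹ * (Aᵀ)⁻¹) + Sy)))⁻¹ *
          psdSqrt ((σ ^ 2 / 4) • (A⁻¹ * Sx⁻¹ * (Aᵀ)⁻¹) + Sy) -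
        (σ / 2) • (Aᵀ)⁻¹ = C := by
  have uX : IsUnit Sx.det := (Matrix.isUnit_iff_isUnit_det _).1 hX.isUnit
  have uAT : IsUnit (Aᵀ).det := by rwa [Matrix.det_transpose]
  have hXT : Sxᵀ = Sx := by simpa using hX.1.eq
  have hYT : Syᵀ = Sy := by simpa using hY.1.eq
  set K := Aᵀ * Sx * A with hK
  have hKi : A⁻¹ * Sx⁻¹ * (Aᵀ)⁻¹ = K⁻¹ := by
    rw [hK, Matrix.mul_inv_rev, Matrix.mul_inv_rev, Matrix.mul_assoc]
  have uK : IsUnit K.det := by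
    rw [hK, Matrix.det_mul, Matrix.det_mul]; exact (uAT.mul uX).mul uA
  have hKpd : K.PosDef := by
    have := hX.conjTranspose_mul_mul_same (B := A)
      (Matrix.mulVec_injective_of_isUnit ((Matrix.isUnit_iff_isUnit_det _).2 uA))
    simpa using this
  have hKT : Kᵀ = K := by simpa using hKpd.1.eq
  rw [hKi] at hP ⊢
  set D := A⁻¹ * Sx⁻¹ * C with hD
  have hCD : C = Sx * A * D := by
    rw [hD]
    simp only [Matrix.mul_assoc]
    rw [Matrix.mul_nonsing_inv_cancel_left _ _ uA, Matrix.mul_nonsing_inv_cancel_left _ _ uX]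
  have hCT : Cᵀ * Sx⁻¹ * C = Dᵀ * K * D := by
    rw [hCD, hK]
    simp only [Matrix.transpose_mul, hXT, Matrix.mul_assoc]
    rw [Matrix.nonsing_inv_mul_cancel_left _ _ uX]
  have hDeq : σ • D = Sy - Dᵀ * K * D := by
    rw [← hCT, hD]
    have := congrArg (fun Z => Z * Sx⁻¹ * C) hE
    simp only [Matrix.sub_mul, Matrix.smul_mul] at this
    rw [← this, Matrix.mul_nonsing_inv_cancel_right _ _ uX,
      Matrix.nonsing_inv_mul_cancel_right _ _ uC]
  have hDT : σ • Dᵀ = σ • D := by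
    have := congrArg Matrix.transpose hDeq
    rw [Matrix.transpose_smul] at this
    rw [this, hDeq]
    simp [hKT, hYT, Matrix.mul_assoc]
  have hDT : Dᵀ = D := smul_right_injective _ hσ.ne' hDT
  rw [hDT] at hDeq
  have hPH : (D + (σ / 2) • K⁻¹).IsHermitian := by
    have : (D + (σ / 2) • K⁻¹)ᵀ = D + (σ / 2) • K⁻¹ := by
      rw [Matrix.transpose_add, Matrix.transpose_smul, Matrix.transpose_nonsing_inv, hKT, hDT]
    simpa [Matrix.IsHermitian] using this
  have hPpd := hP hPH
  have hMpd : ((σ ^ 2 / 4) • K⁻¹ + Sy).PosDef :=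
    (hKpd.inv.smul (by positivity)).add hY
  have hPKP : (D + (σ / 2) • K⁻¹) * K * (D + (σ / 2) • K⁻¹) = (σ ^ 2 / 4) • K⁻¹ + Sy := by
    have : Sy = σ • D + D * K * D := by rw [hDeq]; abel
    rw [this]
    simp only [Matrix.add_mul, Matrix.mul_add, Matrix.smul_mul, Matrix.mul_smul, Matrix.mul_assoc,
      Matrix.mul_nonsing_inv _ uK, Matrix.nonsing_inv_mul_cancel_left _ _ uK, Matrix.mul_one]
    module
  have hf := sqrt_formula_unique hPpd hMpd hPKP
  set S := psdSqrt ((σ ^ 2 / 4) • K⁻¹ + Sy)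
  have e1 : S * Aᵀ * Sx * A * S = S * K * S := by
    rw [hK]; simp only [Matrix.mul_assoc]
  have e2 : Sx * A * S * (psdSqrt (S * K * S))⁻¹ * S = Sx * A * (S * (psdSqrt (S * K * S))⁻¹ * S) := by
    simp only [Matrix.mul_assoc]
  rw [e1, e2, hf, Matrix.mul_add, ← hCD, ← hKi]
  simp only [Matrix.mul_smul, Matrix.mul_assoc]
  rw [Matrix.mul_nonsing_inv_cancel_left _ _ uA, Matrix.mul_nonsing_inv_cancel_left _ _ uX]
  abel

/-- Facts about the closed form at a point. -/
theorem G_facts {n : ℕ} {Sx Sy A C : Matrix (Fin n) (Fin n) ℝ} {σ : ℝ} (hσ : 0 < σ)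
    (hX : Sx.PosDef) (hY : Sy.PosDef) (uA : IsUnit A.det)
    (hC : C = Sx * A * psdSqrt ((σ ^ 2 / 4) • (A⁻¹ * Sx⁻¹ * (Aᵀ)⁻¹) + Sy) *
          (psdSqrt (psdSqrt ((σ ^ 2 / 4) • (A⁻¹ * Sx⁻¹ * (Aᵀ)⁻¹) + Sy) * Aᵀ * Sx * A *
              psdSqrt ((σ ^ 2 / 4) • (A⁻¹ * Sx⁻¹ * (Aᵀ)⁻¹) + Sy)))⁻¹ *
          psdSqrt ((σ ^ 2 / 4) • (A⁻¹ * Sx⁻¹ * (Aᵀ)⁻¹) + Sy) -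
        (σ / 2) • (Aᵀ)⁻¹) :
    IsUnit C.det ∧ (A⁻¹ * Sx⁻¹ * C + (σ / 2) • (A⁻¹ * Sx⁻¹ * (Aᵀ)⁻¹)).PosDef ∧
      Sy * C⁻¹ * Sx - Cᵀ = σ • A⁻¹ ∧
      ∀ H, Sy * C⁻¹ * H * C⁻¹ * Sx + Hᵀ = 0 → H = 0 := by
  have uX : IsUnit Sx.det := (Matrix.isUnit_iff_isUnit_det _).1 hX.isUnit
  have uAT : IsUnit (Aᵀ).det := by rwa [Matrix.det_transpose]
  have hXT : Sxᵀ = Sx := by simpa using hX.1.eq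
  have hYT : Syᵀ = Sy := by simpa using hY.1.eq
  set K := Aᵀ * Sx * A with hK
  have hKi : A⁻¹ * Sx⁻¹ * (Aᵀ)⁻¹ = K⁻¹ := by
    rw [hK, Matrix.mul_inv_rev, Matrix.mul_inv_rev, Matrix.mul_assoc]
  have uK : IsUnit K.det := by
    rw [hK, Matrix.det_mul, Matrix.det_mul]; exact (uAT.mul uX).mul uA
  have hKpd : K.PosDef := by
    have := hX.conjTranspose_mul_mul_same (B := A)
      (Matrix.mulVec_injective_of_isUnit ((Matrix.isUnit_iff_isUnit_det _).2 uA))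
    simpa using this
  have hKT : Kᵀ = K := by simpa using hKpd.1.eq
  rw [hKi] at hC ⊢
  have hMpd : ((σ ^ 2 / 4) • K⁻¹ + Sy).PosDef :=
    (hKpd.inv.smul (by positivity)).add hY
  obtain ⟨P, hP, hPKP, hf⟩ := sqrt_formula_exists hKpd hMpd
  have hPT : Pᵀ = P := by simpa using hP.1.eq
  obtain ⟨D, hD⟩ : ∃ D, D = P - (σ / 2) • K⁻¹ := ⟨_, rfl⟩
  have hCD : C = Sx * A * D := by
    set S := psdSqrt ((σ ^ 2 / 4) • K⁻¹ + Sy)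
    have e1 : S * Aᵀ * Sx * A * S = S * K * S := by
      rw [hK]; simp only [Matrix.mul_assoc]
    have e2 : Sx * A * S * (psdSqrt (S * K * S))⁻¹ * S =
        Sx * A * (S * (psdSqrt (S * K * S))⁻¹ * S) := by
      simp only [Matrix.mul_assoc]
    rw [hC, e1, e2, hf, hD, Matrix.mul_sub, ← hKi]
    simp only [Matrix.mul_smul, Matrix.mul_assoc]
    rw [Matrix.mul_nonsing_inv_cancel_left _ _ uA, Matrix.mul_nonsing_inv_cancel_left _ _ uX]
  have hPD : P = D + (σ / 2) • K⁻¹ := by rw [hD]; abel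
  have hDT : Dᵀ = D := by
    rw [hD, Matrix.transpose_sub, Matrix.transpose_smul, Matrix.transpose_nonsing_inv, hKT, hPT]
  have hSy : Sy = (D * K + σ • 1) * D := by
    rw [hPD] at hPKP
    simp only [Matrix.add_mul, Matrix.mul_add, Matrix.smul_mul, Matrix.mul_smul, Matrix.mul_assoc,
      Matrix.mul_nonsing_inv _ uK, Matrix.nonsing_inv_mul_cancel_left _ _ uK, Matrix.mul_one]
      at hPKP
    rw [← sub_eq_iff_eq_add'] at hPKP
    rw [← hPKP]
    simp only [Matrix.add_mul, Matrix.smul_mul, Matrix.one_mul, Matrix.mul_assoc]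
    module
  have uD : IsUnit D.det := by
    have uY : IsUnit Sy.det := (Matrix.isUnit_iff_isUnit_det _).1 hY.isUnit
    rw [hSy, Matrix.det_mul] at uY
    exact isUnit_of_mul_isUnit_right uY
  have uC : IsUnit C.det := by
    rw [hCD, Matrix.det_mul, Matrix.det_mul]; exact (uX.mul uA).mul uD
  have hCi : C⁻¹ = D⁻¹ * (A⁻¹ * Sx⁻¹) := by
    rw [hCD, Matrix.mul_inv_rev, Matrix.mul_inv_rev]
  have hSyD : Sy * D⁻¹ = D * K + σ • 1 := by
    rw [hSy, Matrix.mul_nonsing_inv_cancel_right _ _ uD]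
  refine ⟨uC, ?_, ?_, ?_⟩
  · have : A⁻¹ * Sx⁻¹ * C = D := by
      rw [hCD]
      simp only [Matrix.mul_assoc]
      rw [Matrix.nonsing_inv_mul_cancel_left _ _ uX, Matrix.nonsing_inv_mul_cancel_left _ _ uA]
    rw [this, ← hPD]
    exact hP
  · rw [hCi, ← Matrix.mul_assoc, hSyD, hCD, hK]
    simp only [Matrix.transpose_mul, hXT, hDT, Matrix.mul_assoc, Matrix.add_mul, Matrix.smul_mul,
      Matrix.one_mul, Matrix.nonsing_inv_mul _ uX, Matrix.mul_one,
      Matrix.mul_nonsing_inv_cancel_left _ _ uA, Matrix.mul_nonsing_inv _ uA]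
    abel
  · intro H hH
    obtain ⟨M, hM⟩ : ∃ M, M = A⁻¹ * Sx⁻¹ * H := ⟨_, rfl⟩
    have hHM : H = Sx * A * M := by
      rw [hM]
      simp only [Matrix.mul_assoc]
      rw [Matrix.mul_nonsing_inv_cancel_left _ _ uA, Matrix.mul_nonsing_inv_cancel_left _ _ uX]
    have hR := psdSqrt_pd hX
    have hr := psdSqrt_sq hX.posSemidef
    set R := psdSqrt Sx
    have hRT : Rᵀ = R := by simpa using hR.1.eq
    have hBB : (R * A)ᵀ * (R * A) = K := by
      rw [hK, ← hr, Matrix.transpose_mul, hRT]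
      simp only [Matrix.mul_assoc]
    have : M = 0 := by
      refine sylv_inj (B := R * A) (P := P) (D := D) (σ := σ) hσ.ne'
        (hR.isUnit.mul ((Matrix.isUnit_iff_isUnit_det _).2 uA)) hP hDT ?_ ?_
      · rw [hBB, hPD, Matrix.add_mul, Matrix.smul_mul, Matrix.nonsing_inv_mul _ uK]
      · rw [hBB]
        have h2 := congrArg (fun Z => Z * (A * D)) hH
        have h3 : Sy * C⁻¹ * H * C⁻¹ * Sx = (D * K + σ • 1) * M * D⁻¹ * A⁻¹ := by
          rw [hCi, ← hSyD, hM]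
          simp only [Matrix.mul_assoc, Matrix.nonsing_inv_mul _ uX, Matrix.mul_one]
        simp only [Matrix.zero_mul] at h2
        rw [h3, hHM, Matrix.add_mul, ← Matrix.mul_assoc _ A D,
          Matrix.nonsing_inv_mul_cancel_right _ _ uA,
          Matrix.nonsing_inv_mul_cancel_right _ _ uD] at h2
        rw [← h2, hK]
        simp only [Matrix.transpose_mul, hXT, Matrix.mul_assoc, Matrix.add_mul, Matrix.smul_mul,
          Matrix.one_mul]
    rw [hHM, this, Matrix.mul_zero]

/-- Theorem 3(ii), formula (cs4) of Bojilov–Galichon in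
non-vectorized form: the equilibrium map
`G(A) = Sx A Δ(A) (Δ(A) Aᵀ Sx A Δ(A))^{-1/2} Δ(A) − (σ/2) A⁻ᵀ`, with
`Δ(A) = ((σ²/4)·A⁻¹Sx⁻¹A⁻ᵀ + Sy)^{1/2}`, is Fréchet differentiable at an
invertible `A₀`; writing `Sxy = G(A₀)`, the linear map
`L(H) = (1/σ)·A₀·(Sy Sxy⁻¹ H Sxy⁻¹ Sx + Hᵀ)·A₀` is bijective and the
derivative of `G` at `A₀` is the inverse of `L`. -/
theorem stmt16 (n : ℕ) (hn : 1 ≤ n)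
    (Sx Sy : Matrix (Fin n) (Fin n) ℝ)
    (hX : Sx.PosDef) (hY : Sy.PosDef) (σ : ℝ) (hσ : 0 < σ)
    (G : Matrix (Fin n) (Fin n) ℝ → Matrix (Fin n) (Fin n) ℝ)
    (hG : G = fun A =>
      Sx * A * psdSqrt ((σ ^ 2 / 4) • (A⁻¹ * Sx⁻¹ * (Aᵀ)⁻¹) + Sy) *
          (psdSqrt (psdSqrt ((σ ^ 2 / 4) • (A⁻¹ * Sx⁻¹ * (Aᵀ)⁻¹) + Sy) * Aᵀ * Sx * A *
              psdSqrt ((σ ^ 2 / 4) • (A⁻¹ * Sx⁻¹ * (Aᵀ)⁻¹) + Sy)))⁻¹ *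
          psdSqrt ((σ ^ 2 / 4) • (A⁻¹ * Sx⁻¹ * (Aᵀ)⁻¹) + Sy) -
        (σ / 2) • (Aᵀ)⁻¹)
    (A₀ : Matrix (Fin n) (Fin n) ℝ) (hA₀ : IsUnit A₀.det)
    (Sxy : Matrix (Fin n) (Fin n) ℝ) (hSxy : Sxy = G A₀)
    (L : Matrix (Fin n) (Fin n) ℝ → Matrix (Fin n) (Fin n) ℝ)
    (hL : L = fun H => (1 / σ) • (A₀ * (Sy * Sxy⁻¹ * H * Sxy⁻¹ * Sx + Hᵀ) * A₀)) :
    Function.Bijective L ∧ DifferentiableAt ℝ G A₀ ∧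
      ∀ H : Matrix (Fin n) (Fin n) ℝ, L (fderiv ℝ G A₀ H) = H := by
  have hC0 := hSxy.trans (congrFun hG A₀)
  obtain ⟨uC, hP0, hE, hinj⟩ := G_facts hσ hX hY hA₀ hC0
  have uAi : IsUnit (A₀⁻¹).det := Matrix.isUnit_nonsing_inv_det _ hA₀
  have uE : IsUnit (Sy * Sxy⁻¹ * Sx - Sxyᵀ).det := by
    rw [hE, Matrix.det_smul]
    exact ((isUnit_iff_ne_zero.2 hσ.ne').pow _).mul uAi
  have hEi : (Sy * Sxy⁻¹ * Sx - Sxyᵀ)⁻¹ = σ⁻¹ • A₀ := by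
    apply Matrix.inv_eq_right_inv
    rw [hE, Matrix.smul_mul, Matrix.mul_smul, Matrix.nonsing_inv_mul _ hA₀, smul_smul,
      mul_inv_cancel₀ hσ.ne', one_smul]
  obtain ⟨f', hf', ef'⟩ := strict_F (σ := σ) uC uE
  set F : Matrix (Fin n) (Fin n) ℝ → Matrix (Fin n) (Fin n) ℝ :=
    fun X => σ • (Sy * X⁻¹ * Sx - Xᵀ)⁻¹ with hF
  have hFC : F Sxy = A₀ := by
    rw [hF]
    simp only [hEi, smul_smul, mul_inv_cancel₀ hσ.ne', one_smul]
  have hLf : L = f' := by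
    ext1 H
    rw [ef', hL, hEi]
    simp only [Matrix.smul_mul, Matrix.mul_smul, smul_smul]
    congr 1
    field_simp
  have hfi : Function.Injective f' := by
    rw [injective_iff_map_eq_zero]
    intro H hH
    apply hinj
    rw [← hLf, hL] at hH
    have h1 := (smul_eq_zero.1 hH).resolve_left (by positivity)
    have h2 := congrArg (fun Z => A₀⁻¹ * Z * A₀⁻¹) h1
    simp only [Matrix.mul_zero, Matrix.zero_mul] at h2
    rwa [← Matrix.mul_assoc, Matrix.mul_nonsing_inv_cancel_right _ _ hA₀,
      Matrix.nonsing_inv_mul_cancel_left _ _ hA₀] at h2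
  have hfs : Function.Surjective f' :=
    (LinearMap.injective_iff_surjective (f := f'.toLinearMap)).1 hfi
  let e : Matrix (Fin n) (Fin n) ℝ ≃L[ℝ] Matrix (Fin n) (Fin n) ℝ :=
    (LinearEquiv.ofBijective f'.toLinearMap ⟨hfi, hfs⟩).toContinuousLinearEquiv
  have he : (e : Matrix (Fin n) (Fin n) ℝ →L[ℝ] Matrix (Fin n) (Fin n) ℝ) = f' := by
    ext1 H; rfl
  rw [← he] at hf'
  have hg := hf'.to_localInverse
  have hgr := hf'.eventually_right_inverse
  have hgt := hf'.localInverse_tendsto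
  set g := hf'.localInverse F e Sxy
  rw [hFC] at hg hgr hgt
  have hdet : Continuous (fun X : Matrix (Fin n) (Fin n) ℝ => X.det) := continuous_id.matrix_det
  have ev1 : ∀ᶠ A in 𝓝 A₀, IsUnit A.det := by
    simp only [isUnit_iff_ne_zero]
    exact hdet.continuousAt.eventually_ne hA₀.ne_zero
  have ev2 : ∀ᶠ A in 𝓝 A₀, IsUnit (g A).det := by
    have : ∀ᶠ C in 𝓝 Sxy, IsUnit C.det := by
      simp only [isUnit_iff_ne_zero]
      exact hdet.continuousAt.eventually_ne uC.ne_zero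
    exact hgt.eventually this
  have ev3 : ∀ᶠ A in 𝓝 A₀, (A⁻¹ * Sx⁻¹ * g A + (σ / 2) • (A⁻¹ * Sx⁻¹ * (Aᵀ)⁻¹)).IsHermitian →
      (A⁻¹ * Sx⁻¹ * g A + (σ / 2) • (A⁻¹ * Sx⁻¹ * (Aᵀ)⁻¹)).PosDef := by
    obtain ⟨i', hi', -⟩ := strict_inv hA₀
    have ti : Tendsto (fun A : Matrix (Fin n) (Fin n) ℝ => A⁻¹) (𝓝 A₀) (𝓝 A₀⁻¹) :=
      hi'.continuousAt
    have tT : Tendsto (fun A : Matrix (Fin n) (Fin n) ℝ => (Aᵀ)⁻¹) (𝓝 A₀) (𝓝 (A₀ᵀ)⁻¹) := by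
      simp only [← Matrix.transpose_nonsing_inv]
      exact (continuous_id.matrix_transpose.tendsto _).comp ti
    have tt : Tendsto (fun A => A⁻¹ * Sx⁻¹ * g A + (σ / 2) • (A⁻¹ * Sx⁻¹ * (Aᵀ)⁻¹)) (𝓝 A₀)
        (𝓝 (A₀⁻¹ * Sx⁻¹ * Sxy + (σ / 2) • (A₀⁻¹ * Sx⁻¹ * (A₀ᵀ)⁻¹))) :=
      ((ti.mul_const _).mul hgt).add (((ti.mul_const _).mul tT).const_smul _)
    exact tt.eventually (pd_nhds hP0)
  have hGg : G =ᶠ[𝓝 A₀] g := by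
    filter_upwards [ev1, ev2, ev3, hgr] with A u1 u2 h3 h4
    rw [hG]
    refine G_recover hσ hX hY u1 u2 ?_ h3
    have h5 : (Sy * (g A)⁻¹ * Sx - (g A)ᵀ)⁻¹ = σ⁻¹ • A := by
      have h7 : σ • (Sy * (g A)⁻¹ * Sx - (g A)ᵀ)⁻¹ = A := h4
      have h8 := congrArg (fun Z => σ⁻¹ • Z) h7
      simpa only [smul_smul, inv_mul_cancel₀ hσ.ne', one_smul] using h8
    have h6 : IsUnit ((Sy * (g A)⁻¹ * Sx - (g A)ᵀ)⁻¹).det := by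
      rw [h5, Matrix.det_smul]
      exact ((isUnit_iff_ne_zero.2 (inv_ne_zero hσ.ne')).pow _).mul u1
    rw [← Matrix.nonsing_inv_nonsing_inv _ (Matrix.isUnit_nonsing_inv_det_iff.1 h6), h5]
    apply Matrix.inv_eq_right_inv
    rw [Matrix.smul_mul, Matrix.mul_smul, Matrix.mul_nonsing_inv _ u1, smul_smul,
      inv_mul_cancel₀ hσ.ne', one_smul]
  have hGd : HasFDerivAt G (e.symm : Matrix (Fin n) (Fin n) ℝ →L[ℝ] Matrix (Fin n) (Fin n) ℝ) A₀ :=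
    hg.hasFDerivAt.congr_of_eventuallyEq hGg
  refine ⟨by rw [hLf]; exact ⟨hfi, hfs⟩, hGd.differentiableAt, fun H => ?_⟩
  rw [hGd.fderiv, hLf, ← he]
  exact e.apply_symm_apply H
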